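/- Restriction inequality via the least prime factor: Let m ≥ 3 be an integer and let p = c₂(m) be the smallest divisor of m that is at least 2. Let ξ₁, …, ξ_n be i.i.d. random variables each uniform on Ω_m, and let a ∈ ℂ^n. Then for every subset I ⊆ {1, …, n} and every t ∈ ℝ, Prob{ Re(∑_{i ∈ I} a_i ξ_i) ≥ t } ≤ p · Prob{ Re(∑_{i=1}^n a_i ξ_i) ≥ t }. -/

import Mathlib

open scoped BigOperators

/-- `omegaRoot m k = e^{2πik/m}`; for `k ∈ Fin m` these enumerate the `m`-th roots of
unity `Ω_m`, so a uniform random variable on `Fin m` composed with `omegaRoot m` is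
uniform on `Ω_m`. -/
noncomputable def omegaRoot (m k : ℕ) : ℂ :=
  Complex.exp (2 * Real.pi * Complex.I * k / m)

theorem omegaRoot_eq_pow (m k : ℕ) :
    omegaRoot m k = Complex.exp (2 * Real.pi * Complex.I / m) ^ k := by
  rw [omegaRoot, ← Complex.exp_nat_mul]
  congr 1
  ring

theorem omegaRoot_mod {m : ℕ} (hm : m ≠ 0) (k : ℕ) : omegaRoot m (k % m) = omegaRoot m k := by
  simp only [omegaRoot_eq_pow]
  exact (pow_eq_pow_mod _ (Complex.isPrimitiveRoot_exp m hm).pow_eq_one).symm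

theorem omegaRoot_fin_add {m : ℕ} (hm : m ≠ 0) (x y : Fin m) :
    omegaRoot m (x + y : Fin m) = omegaRoot m x * omegaRoot m y := by
  rw [Fin.val_add, omegaRoot_mod hm]
  simp only [omegaRoot_eq_pow, pow_add]

/-- The sum of the `p`-th roots of unity vanishes. -/
theorem sum_omegaRoot_mul_div_eq_zero {m p : ℕ} (hm : m ≠ 0) (hp : 1 < p) (h : p ∣ m) :
    ∑ k : Fin p, omegaRoot m (k * (m / p)) = 0 := by
  have hζ := (Complex.isPrimitiveRoot_exp m hm).pow (Nat.pos_of_ne_zero hm)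
    (Nat.div_mul_cancel h).symm
  rw [← hζ.geom_sum_eq_zero hp, ← Fin.sum_univ_eq_sum_range]
  refine Finset.sum_congr rfl fun k _ => ?_
  rw [omegaRoot_eq_pow, ← pow_mul, mul_comm (k : ℕ)]

/-- Among the translates `x + w k * y` with `∑ k, w k = 0`, one has real part at least `x.re`. -/
theorem exists_re_le_re_add_mul {ι : Type*} [Fintype ι] [Nonempty ι] {w : ι → ℂ}
    (hw : ∑ k, w k = 0) (x y : ℂ) : ∃ k, x.re ≤ (x + w k * y).re := by
  have h : ∑ k, (w k * y).re = 0 := by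
    rw [← Complex.re_sum, ← Finset.sum_mul, hw, zero_mul, Complex.zero_re]
  obtain ⟨k, -, hk⟩ := Finset.exists_le_of_sum_le (s := Finset.univ) Finset.univ_nonempty
    (f := fun _ : ι => (0 : ℝ)) (g := fun k => (w k * y).re) (by rw [h, Finset.sum_const_zero])
  exact ⟨k, by rw [Complex.add_re]; linarith⟩

/-- Restriction inequality via the least prime factor `p = c₂(m) = m.minFac`:
for i.i.d. `ξ₁,…,ξ_n` uniform on `Ω_m` (`m ≥ 3`), any `I ⊆ {1,…,n}` and `t ∈ ℝ`,
`Prob{Re(∑_{i ∈ I} aᵢξᵢ) ≥ t} ≤ p·Prob{Re(∑_{i=1}^n aᵢξᵢ) ≥ t}`.  Probabilities are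
counting measures over `κ : Fin n → Fin m` (with `ξᵢ = omegaRoot m (κ i)`) divided
by `m^n`. -/
theorem restriction_inequality_least_prime_factor
    (n m : ℕ) (hm : 3 ≤ m) (a : Fin n → ℂ) (I : Finset (Fin n)) (t : ℝ) :
    (Nat.card {κ : Fin n → Fin m //
        t ≤ (∑ i ∈ I, a i * omegaRoot m (κ i)).re} : ℝ) / (m : ℝ) ^ n
      ≤ (m.minFac : ℝ) * ((Nat.card {κ : Fin n → Fin m //
          t ≤ (∑ i, a i * omegaRoot m (κ i)).re} : ℝ) / (m : ℝ) ^ n) := by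
  have hm0 : m ≠ 0 := by omega
  have : NeZero m := ⟨hm0⟩
  have hp : m.minFac.Prime := Nat.minFac_prime (by omega)
  have : NeZero m.minFac := ⟨hp.ne_zero⟩
  let s (k : Fin m.minFac) : Fin m := Fin.ofNat m (k * (m / m.minFac))
  have hs (k) : omegaRoot m (s k) = omegaRoot m (k * (m / m.minFac)) := omegaRoot_mod hm0 _
  have hsum : ∑ k, omegaRoot m (s k) = 0 := by
    simp only [hs]
    exact sum_omegaRoot_mul_div_eq_zero hm0 hp.one_lt m.minFac_dvd
  let T (k : Fin m.minFac) (κ : Fin n → Fin m) : Fin n → Fin m :=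
    κ + fun i => if i ∈ I then 0 else s k
  have hT (k κ) : ∑ i, a i * omegaRoot m (T k κ i) =
      ∑ i ∈ I, a i * omegaRoot m (κ i) +
        omegaRoot m (s k) * ∑ i ∈ Iᶜ, a i * omegaRoot m (κ i) := by
    rw [← Finset.sum_add_sum_compl I, Finset.mul_sum]
    congr 1
    · refine Finset.sum_congr rfl fun i hi => ?_
      simp [T, hi]
    · refine Finset.sum_congr rfl fun i hi => ?_
      simp only [T, Pi.add_apply, if_neg (Finset.mem_compl.mp hi), omegaRoot_fin_add hm0]
      ring
  have hex (κ : {κ : Fin n → Fin m // t ≤ (∑ i ∈ I, a i * omegaRoot m (κ i)).re}) :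
      ∃ k, t ≤ (∑ i, a i * omegaRoot m (T k κ i)).re := by
    obtain ⟨k, hk⟩ := exists_re_le_re_add_mul hsum (∑ i ∈ I, a i * omegaRoot m (κ.1 i))
      (∑ i ∈ Iᶜ, a i * omegaRoot m (κ.1 i))
    exact ⟨k, (κ.2.trans hk).trans_eq (by rw [hT])⟩
  choose k hk using hex
  have hcard := Nat.card_le_card_of_injective
    (fun κ => (k κ, (⟨T (k κ) κ, hk κ⟩ :
      {κ : Fin n → Fin m // t ≤ (∑ i, a i * omegaRoot m (κ i)).re}))) (by
    intro κ κ' h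
    simp only [Prod.mk.injEq, Subtype.mk.injEq] at h
    obtain ⟨h₁, h₂⟩ := h
    rw [h₁] at h₂
    exact Subtype.ext (add_right_cancel h₂))
  rw [Nat.card_prod, Nat.card_fin] at hcard
  rw [← mul_div_assoc]
  gcongr
  exact_mod_cast hcard
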